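/- Let n, d be positive integers, a ∈ ℝ^d. Let M : ℝ → ℝ^{n×n} be differentiable with each M(t) symmetric and m_1‖v‖² ≤ vᵀM(t)v for a fixed m_1 > 0 and all t, v; let C : ℝ → ℝ^{n×n} with M'(t) − 2C(t) skew-symmetric for all t; let K ∈ ℝ^{n×n} be symmetric positive definite; let Y : ℝ → ℝ^{n×d}; let P ∈ ℝ^{d×d} be symmetric positive definite; let ψ : ℝ^d → ℝ be twice continuously differentiable and convex with ∇²ψ(Pâ(t)) invertible for all t; and let s : ℝ → ℝ^n, â : ℝ → ℝ^d be differentiable and satisfy, for all t ≥ 0, M(t)s'(t) + (C(t) + K)s(t) = Y(t)(a − â(t)) and â'(t) = P⁻¹(∇²ψ(Pâ(t)))⁻¹P⁻¹ Y(t)ᵀ s(t). Then V(t) = ½ s(t)ᵀ M(t) s(t) + d_ψ(Pa ‖ Pâ(t)) is nonincreasing on [0, ∞); moreover, sup_{t ≥ 0} ‖s(t)‖² ≤ 2V(0)/m_1 and ∫₀^T s(t)ᵀ K s(t) dt ≤ V(0) for every T > 0. -/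

import Mathlib

open scoped Matrix.Norms.L2Operator RealInnerProductSpace Matrix

/-- Application of a real matrix to a vector of `EuclideanSpace`. -/
noncomputable def mApp {n m : ℕ} (A : Matrix (Fin n) (Fin m) ℝ)
    (v : EuclideanSpace ℝ (Fin m)) : EuclideanSpace ℝ (Fin n) :=
  Matrix.toEuclideanLin A v

/-- The Bregman divergence `d_ψ(y ‖ x) = ψ(y) − ψ(x) − ⟨∇ψ(x), y − x⟩`. -/
noncomputable def bregman {d : ℕ} (ψ : EuclideanSpace ℝ (Fin d) → ℝ)
    (y x : EuclideanSpace ℝ (Fin d)) : ℝ :=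
  ψ y - ψ x - ⟪gradient ψ x, y - x⟫

theorem mApp_add_right {n m : ℕ} (A : Matrix (Fin n) (Fin m) ℝ) (v w : EuclideanSpace ℝ (Fin m)) :
    mApp A (v + w) = mApp A v + mApp A w := by
  simp [mApp]

theorem mApp_sub_right {n m : ℕ} (A : Matrix (Fin n) (Fin m) ℝ) (v w : EuclideanSpace ℝ (Fin m)) :
    mApp A (v - w) = mApp A v - mApp A w := by
  simp [mApp]

theorem mApp_add_left {n m : ℕ} (A B : Matrix (Fin n) (Fin m) ℝ) (v : EuclideanSpace ℝ (Fin m)) :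
    mApp (A + B) v = mApp A v + mApp B v := by
  simp [mApp]

theorem mApp_sub_left {n m : ℕ} (A B : Matrix (Fin n) (Fin m) ℝ) (v : EuclideanSpace ℝ (Fin m)) :
    mApp (A - B) v = mApp A v - mApp B v := by
  simp [mApp]

theorem mApp_neg_left {n m : ℕ} (A : Matrix (Fin n) (Fin m) ℝ) (v : EuclideanSpace ℝ (Fin m)) :
    mApp (-A) v = - mApp A v := by
  simp [mApp]

theorem mApp_mul {n m k : ℕ} (A : Matrix (Fin n) (Fin m) ℝ) (B : Matrix (Fin m) (Fin k) ℝ)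
    (v : EuclideanSpace ℝ (Fin k)) :
    mApp A (mApp B v) = mApp (A * B) v := by
  simp [mApp, Matrix.toLpLin_apply, Matrix.mulVec_mulVec]

theorem mApp_one {n : ℕ} (v : EuclideanSpace ℝ (Fin n)) :
    mApp (1 : Matrix (Fin n) (Fin n) ℝ) v = v := by
  simp [mApp]

theorem inner_mApp {n m : ℕ} (A : Matrix (Fin n) (Fin m) ℝ) (v : EuclideanSpace ℝ (Fin m))
    (w : EuclideanSpace ℝ (Fin n)) : ⟪w, mApp A v⟫ = ⟪mApp Aᵀ w, v⟫ := by
  have h : Aᵀ = Aᴴ := by ext i j; simp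
  rw [h]
  simp only [mApp, Matrix.toEuclideanLin_conjTranspose_eq_adjoint]
  rw [LinearMap.adjoint_inner_left]

theorem mApp_hasDerivAt {n m : ℕ} (A : ℝ → Matrix (Fin n) (Fin m) ℝ)
    (s : ℝ → EuclideanSpace ℝ (Fin m)) (t : ℝ) {A' : Matrix (Fin n) (Fin m) ℝ}
    {s' : EuclideanSpace ℝ (Fin m)}
    (hA : HasDerivAt A A' t) (hs : HasDerivAt s s' t) :
    HasDerivAt (fun t => mApp (A t) (s t)) (mApp A' (s t) + mApp (A t) s') t := by
  let L0 : Matrix (Fin n) (Fin m) ℝ →ₗ[ℝ]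
      (EuclideanSpace ℝ (Fin m) →L[ℝ] EuclideanSpace ℝ (Fin n)) :=
    (LinearMap.toContinuousLinearMap (𝕜 := ℝ) (E := EuclideanSpace ℝ (Fin m))
      (F' := EuclideanSpace ℝ (Fin n))).toLinearMap ∘ₗ
      (Matrix.toEuclideanLin (𝕜 := ℝ) (m := Fin n) (n := Fin m)).toLinearMap
  let L := LinearMap.toContinuousLinearMap L0
  have h1 : HasDerivAt (fun t => L (A t)) (L A') t := L.hasFDerivAt.comp_hasDerivAt t hA
  exact h1.clm_apply hs

theorem bregman_nonneg {d : ℕ} (ψ : EuclideanSpace ℝ (Fin d) → ℝ) (hψ : Differentiable ℝ ψ)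
    (hc : ConvexOn ℝ Set.univ ψ) (y x : EuclideanSpace ℝ (Fin d)) : 0 ≤ bregman ψ y x := by
  have hg : ConvexOn ℝ Set.univ (fun r : ℝ => ψ (AffineMap.lineMap x y r)) :=
    hc.comp_affineMap (AffineMap.lineMap x y)
  have hd : HasDerivAt (fun r : ℝ => ψ (AffineMap.lineMap x y r)) ⟪gradient ψ x, y - x⟫ 0 := by
    have h1 : HasFDerivAt ψ (InnerProductSpace.toDual ℝ _ (gradient ψ x))
        (AffineMap.lineMap x y (0 : ℝ)) := by
      rw [AffineMap.lineMap_apply_zero]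
      exact (hψ x).hasGradientAt.hasFDerivAt
    have h2 := h1.comp_hasDerivAt (0 : ℝ) AffineMap.hasDerivAt_lineMap
    simpa [Function.comp_def] using h2
  have := hg.le_slope_of_hasDerivAt (Set.mem_univ 0) (Set.mem_univ 1) one_pos hd
  simp only [slope_def_field, AffineMap.lineMap_apply_zero, AffineMap.lineMap_apply_one, sub_zero, div_one] at this
  unfold bregman
  linarith

theorem gradient_differentiable {d : ℕ} (ψ : EuclideanSpace ℝ (Fin d) → ℝ) (hψ : ContDiff ℝ 2 ψ) :
    Differentiable ℝ (gradient ψ) := by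
  have h : Differentiable ℝ (fderiv ℝ ψ) :=
    (hψ.fderiv_right (m := 1) (by norm_num)).differentiable (by norm_num)
  exact (InnerProductSpace.toDual ℝ (EuclideanSpace ℝ (Fin d))).symm.toContinuousLinearEquiv.differentiable.comp h

theorem bregman_hasDerivAt {d : ℕ} (ψ : EuclideanSpace ℝ (Fin d) → ℝ) (hψ : ContDiff ℝ 2 ψ)
    (y : EuclideanSpace ℝ (Fin d)) (x : ℝ → EuclideanSpace ℝ (Fin d)) (t : ℝ)
    {x' : EuclideanSpace ℝ (Fin d)} (hx : HasDerivAt x x' t) :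
    HasDerivAt (fun t => bregman ψ y (x t)) (-⟪fderiv ℝ (gradient ψ) (x t) x', y - x t⟫) t := by
  have h1 : HasDerivAt (fun t => ψ (x t)) ⟪gradient ψ (x t), x'⟫ t := by
    have h := ((hψ.differentiable (by norm_num)) (x t)).hasGradientAt.hasFDerivAt.comp_hasDerivAt t hx
    simpa [Function.comp_def] using h
  have h2 : HasDerivAt (fun t => gradient ψ (x t)) (fderiv ℝ (gradient ψ) (x t) x') t :=
    (gradient_differentiable ψ hψ (x t)).hasFDerivAt.comp_hasDerivAt t hx
  have h3 := ((hasDerivAt_const t (ψ y)).sub h1).sub (h2.inner ℝ ((hasDerivAt_const t y).sub hx))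
  refine h3.congr_deriv ?_
  simp only [zero_sub, inner_neg_right]
  simp

/-- In the `δ = 0` case, the Lyapunov-like function
`V(t) = ½ s(t)ᵀ M(t) s(t) + d_ψ(Pa ‖ Pâ(t))` is nonincreasing on `[0, ∞)`; moreover
`sup_{t ≥ 0} ‖s(t)‖² ≤ 2V(0)/m₁` (so `s ∈ L∞`) and `∫₀^T sᵀKs ≤ V(0)` (so `s ∈ L2`). -/
theorem stmt_10 {n d : ℕ} (hn : 0 < n) (hd : 0 < d)
    (a : EuclideanSpace ℝ (Fin d))
    (M : ℝ → Matrix (Fin n) (Fin n) ℝ) (hM : Differentiable ℝ M)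
    (hMsymm : ∀ t, (M t).IsSymm)
    (m₁ : ℝ) (hm₁ : 0 < m₁)
    (hMlow : ∀ (t : ℝ) (v : EuclideanSpace ℝ (Fin n)),
      m₁ * ‖v‖ ^ 2 ≤ ⟪v, mApp (M t) v⟫)
    (C : ℝ → Matrix (Fin n) (Fin n) ℝ)
    (hskew : ∀ t, (deriv M t - 2 • C t)ᵀ = -(deriv M t - 2 • C t))
    (K : Matrix (Fin n) (Fin n) ℝ) (hK : K.PosDef)
    (Y : ℝ → Matrix (Fin n) (Fin d) ℝ)
    (P : Matrix (Fin d) (Fin d) ℝ) (hP : P.PosDef)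
    (ψ : EuclideanSpace ℝ (Fin d) → ℝ) (hψ : ContDiff ℝ 2 ψ)
    (hψconv : ConvexOn ℝ Set.univ ψ)
    (s : ℝ → EuclideanSpace ℝ (Fin n)) (hs : Differentiable ℝ s)
    (ah : ℝ → EuclideanSpace ℝ (Fin d)) (hah : Differentiable ℝ ah)
    (hHessInv : ∀ t : ℝ, IsUnit (fderiv ℝ (gradient ψ) (mApp P (ah t))))
    (hdyn : ∀ t : ℝ, 0 ≤ t →
      mApp (M t) (deriv s t) + mApp (C t + K) (s t) = mApp (Y t) (a - ah t))
    (hadapt : ∀ t : ℝ, 0 ≤ t → deriv ah t = mApp P⁻¹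
      ((Ring.inverse (fderiv ℝ (gradient ψ) (mApp P (ah t))))
        (mApp P⁻¹ (mApp (Y t)ᵀ (s t))))) :
    AntitoneOn
      (fun t => (1 / 2 : ℝ) * ⟪s t, mApp (M t) (s t)⟫ + bregman ψ (mApp P a) (mApp P (ah t)))
      (Set.Ici 0) ∧
    (∀ t : ℝ, 0 ≤ t → ‖s t‖ ^ 2 ≤
      2 * ((1 / 2 : ℝ) * ⟪s 0, mApp (M 0) (s 0)⟫ + bregman ψ (mApp P a) (mApp P (ah 0))) / m₁) ∧
    (∀ T : ℝ, 0 < T → ∫ t in (0 : ℝ)..T, ⟪s t, mApp K (s t)⟫ ≤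
      (1 / 2 : ℝ) * ⟪s 0, mApp (M 0) (s 0)⟫ + bregman ψ (mApp P a) (mApp P (ah 0))) := by
  have hPt : Pᵀ = P := by simpa using hP.isHermitian.eq
  have hPdet : IsUnit P.det := hP.det_pos.ne'.isUnit
  have hPP : P * P⁻¹ = 1 := Matrix.mul_nonsing_inv P hPdet
  have hderiv : ∀ t : ℝ, 0 ≤ t → HasDerivAt
      (fun t => (1 / 2 : ℝ) * ⟪s t, mApp (M t) (s t)⟫ + bregman ψ (mApp P a) (mApp P (ah t)))
      (-⟪s t, mApp K (s t)⟫) t := by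
    intro t ht
    have hx : HasDerivAt (fun t => mApp P (ah t)) (mApp P (deriv ah t)) t := by
      have h := mApp_hasDerivAt (fun _ => P) ah t (hasDerivAt_const t P) (hah t).hasDerivAt
      simpa [mApp] using h
    have hb := bregman_hasDerivAt ψ hψ (mApp P a) _ t hx
    have hMs := mApp_hasDerivAt M s t (hM t).hasDerivAt (hs t).hasDerivAt
    have hq := ((hs t).hasDerivAt.inner ℝ hMs).const_mul (1 / 2 : ℝ)
    refine (hq.add hb).congr_deriv ?_
    -- the adaptation term
    have e1 : fderiv ℝ (gradient ψ) (mApp P (ah t)) (mApp P (deriv ah t))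
        = mApp P⁻¹ (mApp (Y t)ᵀ (s t)) := by
      rw [hadapt t ht, mApp_mul P, hPP, mApp_one, ← ContinuousLinearMap.mul_apply,
        Ring.mul_inverse_cancel _ (hHessInv t)]
      rfl
    have e2 : ⟪fderiv ℝ (gradient ψ) (mApp P (ah t)) (mApp P (deriv ah t)),
        mApp P a - mApp P (ah t)⟫ = ⟪s t, mApp (Y t) (a - ah t)⟫ := by
      rw [e1, ← mApp_sub_right, inner_mApp P, hPt, mApp_mul P, hPP, mApp_one, inner_mApp (Y t)]
    have e3 : ⟪deriv s t, mApp (M t) (s t)⟫ = ⟪s t, mApp (M t) (deriv s t)⟫ := by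
      rw [inner_mApp, (hMsymm t).eq, real_inner_comm]
    have e4 : ⟪s t, mApp (deriv M t - 2 • C t) (s t)⟫ = 0 := by
      have h := inner_mApp (deriv M t - 2 • C t) (s t) (s t)
      rw [hskew t, mApp_neg_left, inner_neg_left, real_inner_comm] at h
      have h' := real_inner_comm (s t) (mApp (deriv M t - 2 • C t) (s t))
      linarith
    rw [two_smul, mApp_sub_left, mApp_add_left, inner_sub_right, inner_add_right] at e4
    have e5 := congrArg (fun v => ⟪s t, v⟫) (hdyn t ht)
    simp only [mApp_add_left, inner_add_right] at e5
    rw [e2, e3, inner_add_right]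
    linarith
  have hKnn : ∀ v : EuclideanSpace ℝ (Fin n), 0 ≤ ⟪v, mApp K v⟫ := by
    intro v
    have h := hK.posSemidef.dotProduct_mulVec_nonneg v.ofLp
    simpa [mApp, EuclideanSpace.inner_eq_star_dotProduct, Matrix.toLpLin_apply,
      dotProduct_comm] using h
  have hanti : AntitoneOn
      (fun t => (1 / 2 : ℝ) * ⟪s t, mApp (M t) (s t)⟫ + bregman ψ (mApp P a) (mApp P (ah t)))
      (Set.Ici 0) := by
    refine antitoneOn_of_hasDerivWithinAt_nonpos (f' := fun t => -⟪s t, mApp K (s t)⟫)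
      (convex_Ici 0) (fun t ht => (hderiv t ht).continuousAt.continuousWithinAt) ?_ ?_
    · intro t ht
      rw [interior_Ici] at ht
      exact (hderiv t (le_of_lt ht)).hasDerivWithinAt
    · intro t _
      simpa using hKnn (s t)
  have hbn : ∀ t, 0 ≤ bregman ψ (mApp P a) (mApp P (ah t)) := fun t =>
    bregman_nonneg ψ (hψ.differentiable (by norm_num)) hψconv _ _
  refine ⟨hanti, ?_, ?_⟩
  · intro t ht
    have h := hanti (Set.mem_Ici.2 le_rfl) (Set.mem_Ici.2 ht) ht
    simp only at h
    have h1 := hMlow t (s t)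
    have h2 := hbn t
    rw [le_div_iff₀ hm₁]
    linarith
  · intro T hT
    have hcont : Continuous (fun t => ⟪s t, mApp K (s t)⟫) := by
      refine hs.continuous.inner ?_
      exact (LinearMap.continuous_of_finiteDimensional (Matrix.toEuclideanLin K)).comp hs.continuous
    have h := intervalIntegral.integral_eq_sub_of_hasDerivAt (a := 0) (b := T)
      (fun t ht => hderiv t (by rw [Set.uIcc_of_le hT.le] at ht; exact ht.1))
      (hcont.neg.intervalIntegrable 0 T)
    rw [intervalIntegral.integral_neg] at h
    have h1 := hMlow T (s T)
    have h2 := hbn T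
    have h3 : 0 ≤ m₁ * ‖s T‖ ^ 2 := by positivity
    linarith
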